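/- The set (F_{2d}')^δ = {w ∈ F_{2d}' : δ(w) = 0} of constants of δ in the commutator ideal of the free metabelian Lie algebra F_{2d} is the smallest K-linear subspace of F_{2d} that contains the set G and is closed under the operators w ↦ [w, x_i] for i = 1,…,d and w ↦ [[w, x_p], y_q] − [[w, x_q], y_p] for 1 ≤ p < q ≤ d. (These operators realize the action of the generators x_i and u_{pq} = x_p y_q − x_q y_p of the constant algebra K[X_d,Y_d]^δ on F_{2d}', so G generates (F_{2d}')^δ as a K[X_d,Y_d]^δ-module.) -/

import Mathlib

noncomputable section

/-- The free metabelian Lie algebra of rank `2d` over `K`: the quotient of the free Lie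
algebra on `x₁,…,x_d,y₁,…,y_d` (indexed by `Fin d ⊕ Fin d`) by its second derived ideal. -/
abbrev FreeMetabelian (K : Type*) [Field K] (d : ℕ) :=
  FreeLieAlgebra K (Fin d ⊕ Fin d) ⧸
    LieAlgebra.derivedSeries K (FreeLieAlgebra K (Fin d ⊕ Fin d)) 2

variable (K : Type*) [Field K] (d : ℕ)

/-- The image of the free generator `xᵢ` in the free metabelian Lie algebra. -/
def xL (i : Fin d) : FreeMetabelian K d :=
  LieSubmodule.Quotient.mk' _ (FreeLieAlgebra.of K (Sum.inl i))

/-- The image of the free generator `yᵢ` in the free metabelian Lie algebra. -/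
def yL (i : Fin d) : FreeMetabelian K d :=
  LieSubmodule.Quotient.mk' _ (FreeLieAlgebra.of K (Sum.inr i))


/-- The set `G` of Lie constants from the Corollary. -/
def Gset : Set (FreeMetabelian K d) :=
  (Set.range fun i : Fin d => ⁅xL K d i, yL K d i⁆) ∪
  {g | ∃ i j : Fin d, i < j ∧ g = ⁅xL K d i, xL K d j⁆} ∪
  {g | ∃ i j : Fin d, i < j ∧ g = ⁅xL K d i, yL K d j⁆ + ⁅xL K d j, yL K d i⁆} ∪
  {g | ∃ i p q : Fin d, p < q ∧
    g = ⁅⁅xL K d i, xL K d p⁆, yL K d q⁆ - ⁅⁅xL K d i, yL K d p⁆, xL K d q⁆} ∪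
  {g | ∃ i j k : Fin d, i < j ∧ j < k ∧
    g = ⁅⁅xL K d i, xL K d j⁆, yL K d k⁆ - ⁅⁅xL K d i, xL K d k⁆, yL K d j⁆
      + ⁅⁅xL K d j, xL K d k⁆, yL K d i⁆} ∪
  {g | ∃ i j p q : Fin d, i < j ∧ p < q ∧
    g = ⁅⁅⁅xL K d i, xL K d p⁆, yL K d j⁆, yL K d q⁆
      + ⁅⁅⁅yL K d i, yL K d p⁆, xL K d j⁆, xL K d q⁆
      - ⁅⁅⁅xL K d i, yL K d p⁆, yL K d j⁆, xL K d q⁆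
      - ⁅⁅⁅yL K d i, xL K d p⁆, xL K d j⁆, yL K d q⁆}

section EigenspaceDecomposition

variable {K V : Type*} [Field K] [AddCommGroup V] [Module K V]

/-- An invariant subspace containing a sum of eigenvectors with distinct eigenvalues contains
each of the summands. -/
lemma Submodule.mem_of_sum_eigenvectors_mem {ι : Type*} {f : Module.End K V}
    {p : Submodule K V} (hp : ∀ v ∈ p, f v ∈ p) {c : ι → K} (hc : Function.Injective c)
    (s : Finset ι) :
    ∀ m : ι → V, (∀ i, f (m i) = c i • m i) → ∑ i ∈ s, m i ∈ p → ∀ i ∈ s, m i ∈ p := by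
  classical
  induction s using Finset.induction_on with
  | empty => simp
  | insert a s ha ih =>
    intro m hm hsum
    have key : ∑ i ∈ s, (c i - c a) • m i ∈ p := by
      have h := p.sub_mem (hp _ hsum) (p.smul_mem (c a) hsum)
      rw [map_sum, Finset.smul_sum, ← Finset.sum_sub_distrib, Finset.sum_insert ha] at h
      simpa [hm, sub_smul] using h
    have hs : ∀ i ∈ s, m i ∈ p := by
      intro i hi
      have hia : c i - c a ≠ 0 := by
        rw [sub_ne_zero]
        exact fun h => ha (hc h ▸ hi)
      have := ih (fun i => (c i - c a) • m i)
        (fun i => by rw [map_smul, hm, smul_comm]) key i hi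
      exact (p.smul_mem_iff hia).1 this
    intro i hi
    rcases Finset.mem_insert.1 hi with rfl | hi
    · rw [Finset.sum_insert ha] at hsum
      exact (p.add_mem_iff_left (p.sum_mem hs)).1 hsum
    · exact hs i hi

/-- To bound an invariant subspace spanned by eigenvectors it suffices to bound its eigenvectors. -/
lemma Submodule.le_of_inf_eigenspace_le {f : Module.End K V} {p q : Submodule K V}
    (hp : ∀ v ∈ p, f v ∈ p) (htop : p ≤ ⨆ c, f.eigenspace c)
    (hq : ∀ c, p ⊓ f.eigenspace c ≤ q) : p ≤ q := by
  intro v hv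
  obtain ⟨m, hm, rfl⟩ := (Submodule.mem_iSup_iff_exists_finsupp _ _).1 (htop hv)
  have hmem := Submodule.mem_of_sum_eigenvectors_mem hp Function.injective_id m.support m
    (fun c => Module.End.mem_eigenspace_iff.1 (hm c)) hv
  exact q.sum_mem fun c hc => hq c ⟨hmem c hc, hm c⟩

end EigenspaceDecomposition

section Nowicki

open MvPolynomial

variable {K J : Type*} [Field K]

/-- The derivation of `K[x, y]` sending each `xⱼ` to `0` and each `yⱼ` to `xⱼ`. -/
def shiftDer (K J : Type*) [Field K] :
    Derivation K (MvPolynomial (J ⊕ J) K) (MvPolynomial (J ⊕ J) K) :=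
  mkDerivation K (Sum.elim 0 fun j => X (Sum.inl j))

@[simp]
lemma shiftDer_X_inl (j : J) : shiftDer K J (X (Sum.inl j)) = 0 := by simp [shiftDer]

@[simp]
lemma shiftDer_X_inr (j : J) : shiftDer K J (X (Sum.inr j)) = X (Sum.inl j) := by simp [shiftDer]

/-- The determinant `xᵢ yⱼ - xⱼ yᵢ`. -/
def minor (K : Type*) {J : Type*} [Field K] (i j : J) : MvPolynomial (J ⊕ J) K :=
  X (Sum.inl i) * X (Sum.inr j) - X (Sum.inl j) * X (Sum.inr i)

/-- Cayley's operator `∂²/∂xᵢ∂yⱼ - ∂²/∂xⱼ∂yᵢ`. -/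
def cayley (i j : J) (p : MvPolynomial (J ⊕ J) K) : MvPolynomial (J ⊕ J) K :=
  pderiv (Sum.inl i) (pderiv (Sum.inr j) p) - pderiv (Sum.inl j) (pderiv (Sum.inr i) p)

lemma pderiv_comm {σ : Type*} (i j : σ) (p : MvPolynomial σ K) :
    pderiv i (pderiv j p) = pderiv j (pderiv i p) := by
  classical
  have h : ⁅pderiv (R := K) i, pderiv (R := K) j⁆ = 0 := by
    refine derivation_ext fun k => ?_
    simp [Derivation.commutator_apply, Pi.single_apply, apply_ite]
  have := congrArg (fun D : Derivation K (MvPolynomial _ K) (MvPolynomial _ K) => D p) h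
  simpa [Derivation.commutator_apply, sub_eq_zero] using this

lemma shiftDer_pderiv_inr (j : J) (p : MvPolynomial (J ⊕ J) K) :
    shiftDer K J (pderiv (Sum.inr j) p) = pderiv (Sum.inr j) (shiftDer K J p) := by
  classical
  have h : ⁅shiftDer K J, pderiv (R := K) (σ := J ⊕ J) (Sum.inr j)⁆ = 0 := by
    refine derivation_ext fun k => ?_
    rcases k with k | k <;>
      simp [Derivation.commutator_apply, pderiv_X, Pi.single_apply, apply_ite]
  have := congrArg (fun D : Derivation K (MvPolynomial _ K) (MvPolynomial _ K) => D p) h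
  simpa [Derivation.commutator_apply, sub_eq_zero] using this

lemma shiftDer_pderiv_inl (j : J) (p : MvPolynomial (J ⊕ J) K) :
    shiftDer K J (pderiv (Sum.inl j) p) =
      pderiv (Sum.inl j) (shiftDer K J p) - pderiv (Sum.inr j) p := by
  classical
  have h : ⁅shiftDer K J, pderiv (R := K) (Sum.inl j)⁆ = - pderiv (Sum.inr j) := by
    refine derivation_ext fun k => ?_
    rcases k with k | k <;>
      simp [Derivation.commutator_apply, pderiv_X, Pi.single_apply, apply_ite]
  have := congrArg (fun D : Derivation K (MvPolynomial _ K) (MvPolynomial _ K) => D p) h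
  simp only [Derivation.commutator_apply, Derivation.neg_apply] at this
  linear_combination this

lemma shiftDer_cayley (i j : J) (p : MvPolynomial (J ⊕ J) K) :
    shiftDer K J (cayley i j p) = cayley i j (shiftDer K J p) := by
  simp only [cayley, map_sub, shiftDer_pderiv_inl, shiftDer_pderiv_inr]
  rw [pderiv_comm (Sum.inr i) (Sum.inr j)]
  ring

lemma shiftDer_minor (i j : J) : shiftDer K J (minor K i j) = 0 := by
  simp [minor, mul_comm]

/-- Polynomials of total degree at most `n`, as a span of monomials. -/
def degLE (K J : Type*) [Field K] (n : ℕ) : Submodule K (MvPolynomial (J ⊕ J) K) :=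
  Submodule.span K {p | ∃ s : (J ⊕ J) →₀ ℕ, s.degree ≤ n ∧ p = monomial s 1}

lemma pderiv_mem_degLE (k : J ⊕ J) {n : ℕ} {p : MvPolynomial (J ⊕ J) K} (hp : p ∈ degLE K J n) :
    pderiv k p ∈ degLE K J (n - 1) := by
  induction hp using Submodule.span_induction with
  | mem p hp =>
    obtain ⟨s, hs, rfl⟩ := hp
    rw [pderiv_monomial]
    by_cases h : s k = 0
    · simp [h]
    · have : monomial (s - Finsupp.single k 1) (1 * (s k : K)) =
          (s k : K) • monomial (s - Finsupp.single k 1) 1 := by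
        simp [smul_monomial]
      rw [this]
      refine Submodule.smul_mem _ _ (Submodule.subset_span ⟨_, ?_, rfl⟩)
      have hk : Finsupp.single k 1 ≤ s := by
        simpa [Finsupp.single_le_iff] using Nat.one_le_iff_ne_zero.2 h
      have := congrArg Finsupp.degree (tsub_add_cancel_of_le hk)
      rw [map_add, Finsupp.degree_single] at this
      omega
  | zero => simp
  | add p q _ _ hp hq => rw [map_add]; exact add_mem hp hq
  | smul c p _ hp => rw [Derivation.map_smul]; exact Submodule.smul_mem _ _ hp

lemma exists_mem_degLE (p : MvPolynomial (J ⊕ J) K) : ∃ n, p ∈ degLE K J n := by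
  refine ⟨p.support.sup Finsupp.degree, ?_⟩
  rw [p.as_sum]
  refine Submodule.sum_mem _ fun s hs => ?_
  have : monomial s (coeff s p) = coeff s p • monomial s 1 := by simp [smul_monomial]
  rw [this]
  exact Submodule.smul_mem _ _ (Submodule.subset_span ⟨s, Finset.le_sup (f := Finsupp.degree) (by simpa using hs), rfl⟩)

variable [Fintype J]

lemma shiftDer_eq_sum (p : MvPolynomial (J ⊕ J) K) :
    shiftDer K J p = ∑ j, X (Sum.inl j) * pderiv (Sum.inr j) p := by
  classical
  have hsum (q : MvPolynomial (J ⊕ J) K) :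
      (∑ j, (X (Sum.inl j) : MvPolynomial (J ⊕ J) K) •
        (pderiv (Sum.inr j) : Derivation K (MvPolynomial (J ⊕ J) K) _)) q =
      ∑ j, X (Sum.inl j) * pderiv (Sum.inr j) q := by
    rw [← Derivation.coeFnAddMonoidHom_apply, map_sum]
    simp
  rw [← hsum]
  congr 1
  refine derivation_ext fun k => ?_
  rw [hsum]
  rcases k with k | k <;> simp [pderiv_X, Pi.single_apply]

/-- The product of the Euler operators `∑ xᵢ∂/∂xᵢ + 1` and `∑ yᵢ∂/∂yᵢ`. -/
def capelli (K J : Type*) [Field K] [Fintype J] : Module.End K (MvPolynomial (J ⊕ J) K) where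
  toFun p := ∑ i, X (Sum.inl i) * pderiv (Sum.inl i) (∑ j, X (Sum.inr j) * pderiv (Sum.inr j) p) +
    ∑ j, X (Sum.inr j) * pderiv (Sum.inr j) p
  map_add' p q := by simp only [map_add, mul_add, Finset.sum_add_distrib]; abel
  map_smul' c p := by 
    simp only [Derivation.map_smul, mul_smul_comm, ← Finset.smul_sum, smul_add, RingHom.id_apply]

lemma capelli_apply (p : MvPolynomial (J ⊕ J) K) : capelli K J p =
    ∑ i, X (Sum.inl i) * pderiv (Sum.inl i) (∑ j, X (Sum.inr j) * pderiv (Sum.inr j) p) +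
    ∑ j, X (Sum.inr j) * pderiv (Sum.inr j) p := rfl

lemma capelli_monomial (s : (J ⊕ J) →₀ ℕ) (c : K) :
    capelli K J (monomial s c) =
      (((∑ i, s (Sum.inl i)) + 1) * (∑ j, s (Sum.inr j))) • monomial s c := by
  have euler (t : J → J ⊕ J) : ∑ j, X (t j) * pderiv (t j) (monomial s c) =
      (∑ j, s (t j) : ℕ) • monomial s c := by
    simp only [X_mul_pderiv_monomial, Finset.sum_smul]
  rw [capelli_apply, euler]
  simp only [map_nsmul, mul_smul_comm]
  rw [← Finset.smul_sum, euler, smul_smul, ← add_smul]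
  congr 1
  ring

/-- Capelli's identity on the kernel of `shiftDer`. -/
lemma two_mul_capelli {p : MvPolynomial (J ⊕ J) K} (hp : shiftDer K J p = 0) :
    2 * capelli K J p = ∑ i, ∑ j, minor K i j * cayley i j p := by
  classical
  obtain ⟨D, hD⟩ : ∃ D : J → J → MvPolynomial (J ⊕ J) K,
      ∀ i j, pderiv (Sum.inl i) (pderiv (Sum.inr j) p) = D i j := ⟨_, fun _ _ => rfl⟩
  obtain ⟨A, hA⟩ : ∃ A, A = ∑ i, ∑ j, X (Sum.inl i) * X (Sum.inr j) * D i j := ⟨_, rfl⟩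
  obtain ⟨B, hB⟩ : ∃ B, B = ∑ i, ∑ j, X (Sum.inl j) * X (Sum.inr i) * D i j := ⟨_, rfl⟩
  have hB' : ∑ i, ∑ j, X (Sum.inl i) * X (Sum.inr j) * D j i = B :=
    Finset.sum_comm.trans hB.symm
  have hA' : ∑ i, ∑ j, X (Sum.inl j) * X (Sum.inr i) * D j i = A :=
    Finset.sum_comm.trans hA.symm
  have hR : ∑ i, ∑ j, minor K i j * cayley i j p = A - B - B + A := by
    have hsplit : ∑ i, ∑ j, minor K i j * cayley i j p =
        A - B - ∑ i, ∑ j, X (Sum.inl i) * X (Sum.inr j) * D j i +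
          ∑ i, ∑ j, X (Sum.inl j) * X (Sum.inr i) * D j i := by
      simp only [hA, hB, ← Finset.sum_sub_distrib, ← Finset.sum_add_distrib]
      refine Finset.sum_congr rfl fun i _ => Finset.sum_congr rfl fun j _ => ?_
      rw [minor, cayley, hD, hD]
      ring
    rw [hsplit, hA', hB']
  have hE : B + ∑ i, X (Sum.inr i) * pderiv (Sum.inr i) p = 0 := by
    have h : ∑ i, X (Sum.inr i) * pderiv (Sum.inl i) (shiftDer K J p) = 0 := by simp [hp]
    rw [← h, hB, ← Finset.sum_add_distrib]
    refine Finset.sum_congr rfl fun i _ => ?_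
    have hj (j : J) : pderiv (Sum.inl i) (X (Sum.inl j) * pderiv (Sum.inr j) p) =
        (if j = i then pderiv (Sum.inr j) p else 0) + X (Sum.inl j) * D i j := by
      rw [pderiv_mul, pderiv_X, Pi.single_apply, ite_mul, one_mul, zero_mul]
      simp only [Sum.inl.injEq, eq_comm, hD]
    rw [shiftDer_eq_sum, map_sum, Finset.sum_congr rfl fun j _ => hj j, Finset.sum_add_distrib,
      Finset.sum_ite_eq' _ _ _, if_pos (Finset.mem_univ _), mul_add, add_comm, Finset.mul_sum]
    congr 1
    exact Finset.sum_congr rfl fun j _ => by ring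
  have hC : capelli K J p = A + ∑ i, X (Sum.inr i) * pderiv (Sum.inr i) p := by
    rw [capelli_apply, hA]
    refine congrArg (· + _) (Finset.sum_congr rfl fun i _ => ?_)
    rw [map_sum, Finset.mul_sum]
    refine Finset.sum_congr rfl fun j _ => ?_
    rw [pderiv_mul, pderiv_X_of_ne Sum.inr_ne_inl, zero_mul, zero_add, hD, mul_assoc]
  rw [hR, hC]
  linear_combination 2 * hE

lemma capelli_mem_degLE {n : ℕ} {p : MvPolynomial (J ⊕ J) K} (hp : p ∈ degLE K J n) :
    capelli K J p ∈ degLE K J n := by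
  induction hp using Submodule.span_induction with
  | mem p hp =>
    obtain ⟨s, hs, rfl⟩ := hp
    rw [capelli_monomial]
    exact Submodule.smul_of_tower_mem _ _ (Submodule.subset_span ⟨s, hs, rfl⟩)
  | zero => simp
  | add p q _ _ hp hq => rw [map_add]; exact add_mem hp hq
  | smul c p _ hp => rw [map_smul]; exact Submodule.smul_mem _ _ hp

lemma iSup_eigenspace_capelli : ⨆ c, (capelli K J).eigenspace c = ⊤ := by
  refine top_unique fun p _ => ?_
  induction p using MvPolynomial.induction_on' with
  | monomial s c =>
    refine Submodule.mem_iSup_of_mem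
      ((((∑ i, s (Sum.inl i)) + 1) * (∑ j, s (Sum.inr j)) : ℕ) : K) ?_
    rw [Module.End.mem_eigenspace_iff, capelli_monomial, Nat.cast_smul_eq_nsmul]
  | add p q hp hq => exact add_mem (hp trivial) (hq trivial)

lemma coeff_capelli (s : (J ⊕ J) →₀ ℕ) (p : MvPolynomial (J ⊕ J) K) :
    coeff s (capelli K J p) =
      (((∑ i, s (Sum.inl i)) + 1) * (∑ j, s (Sum.inr j)) : ℕ) * coeff s p := by
  classical
  induction p using MvPolynomial.induction_on' with
  | monomial t c =>
    rw [capelli_monomial, ← Nat.cast_smul_eq_nsmul K, coeff_smul, coeff_monomial]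
    split_ifs with h
    · rw [h, smul_eq_mul]
    · simp
  | add p q hp hq => rw [map_add, coeff_add, coeff_add, hp, hq, mul_add]

/-- The generators `xⱼ` and `xᵢ yⱼ - xⱼ yᵢ` of the algebra of constants. -/
def nowickiGenerators (K J : Type*) [Field K] : Set (MvPolynomial (J ⊕ J) K) :=
  (Set.range fun j => X (Sum.inl j)) ∪ {p | ∃ i j, p = minor K i j}

variable [CharZero K]

lemma mem_adjoin_of_capelli_eq_zero {p : MvPolynomial (J ⊕ J) K} (hp : capelli K J p = 0) :
    p ∈ Algebra.adjoin K (nowickiGenerators K J) := by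
  rw [p.as_sum]
  refine sum_mem fun s hs => ?_
  have hs0 : ∀ j, s (Sum.inr j) = 0 := by
    have h := coeff_capelli s p
    rw [hp, coeff_zero, eq_comm, mul_eq_zero, or_iff_left (by simpa using hs), Nat.cast_eq_zero,
      mul_eq_zero, or_iff_right (Nat.succ_ne_zero _)] at h
    simpa using h
  rw [monomial_eq, Finsupp.prod_fintype _ _ (by simp), Fintype.prod_sum_type]
  refine mul_mem (Subalgebra.algebraMap_mem _ _) (mul_mem (Subalgebra.prod_mem _ fun j _ => ?_) ?_)
  · exact Subalgebra.pow_mem _ (Algebra.subset_adjoin (Set.mem_union_left _ (Set.mem_range_self j))) _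
  · simp [hs0]

/-- The algebra of constants of `shiftDer` is generated by the `xⱼ` and the `xᵢ yⱼ - xⱼ yᵢ`. -/
theorem mem_adjoin_of_shiftDer_eq_zero {p : MvPolynomial (J ⊕ J) K} (hp : shiftDer K J p = 0) :
    p ∈ Algebra.adjoin K (nowickiGenerators K J) := by
  suffices h : ∀ n, LinearMap.ker (shiftDer K J).toLinearMap ⊓ degLE K J n ≤
      Subalgebra.toSubmodule (Algebra.adjoin K (nowickiGenerators K J)) by
    obtain ⟨n, hn⟩ := exists_mem_degLE p
    exact h n ⟨hp, hn⟩
  intro n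
  induction n with
  | zero =>
    rintro p ⟨-, hp⟩
    have hle : degLE K J 0 ≤
        Subalgebra.toSubmodule (Algebra.adjoin K (nowickiGenerators K J)) := by
      refine Submodule.span_le.2 ?_
      rintro _ ⟨s, hs, rfl⟩
      rw [Nat.le_zero, Finsupp.degree_eq_zero_iff] at hs
      subst hs
      exact one_mem (Algebra.adjoin K (nowickiGenerators K J))
    exact hle hp
  | succ n ih =>
    have hcay {p} (hp : p ∈ LinearMap.ker (shiftDer K J).toLinearMap ⊓ degLE K J (n + 1))
        (i j : J) : cayley i j p ∈ LinearMap.ker (shiftDer K J).toLinearMap ⊓ degLE K J n := by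
      obtain ⟨hp, hn⟩ := hp
      refine ⟨?_, ?_⟩
      · refine LinearMap.mem_ker.2 ((shiftDer_cayley i j p).trans ?_)
        rw [show shiftDer K J p = 0 from hp]
        simp [cayley]
      · have hle : degLE K J (n - 1) ≤ degLE K J n :=
          Submodule.span_mono fun q ⟨s, hs, hq⟩ => ⟨s, by omega, hq⟩
        have hmem (k l : J ⊕ J) : pderiv k (pderiv l p) ∈ degLE K J n := by
          have h := pderiv_mem_degLE l hn
          rw [Nat.add_sub_cancel] at h
          exact hle (pderiv_mem_degLE k h)
        rw [cayley]
        exact Submodule.sub_mem _ (hmem _ _) (hmem _ _)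
    refine Submodule.le_of_inf_eigenspace_le (f := capelli K J) ?_
      (le_top.trans_eq (iSup_eigenspace_capelli (K := K) (J := J)).symm) ?_
    · intro p hp
      refine ⟨?_, capelli_mem_degLE hp.2⟩
      have h := congrArg (shiftDer K J) (two_mul_capelli (show shiftDer K J p = 0 from hp.1))
      have hzero (i j : J) : shiftDer K J (minor K i j * cayley i j p) = 0 := by
        have h0 : shiftDer K J (cayley i j p) = 0 := (hcay hp i j).1
        rw [Derivation.leibniz, shiftDer_minor, h0, smul_zero, smul_zero, add_zero]
      simp only [map_sum, hzero, Finset.sum_const_zero, two_mul, map_add] at h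
      exact self_eq_neg.1 (eq_neg_of_add_eq_zero_left h)
    · rintro c p ⟨hp, hc⟩
      replace hc := Module.End.mem_eigenspace_iff.1 hc
      by_cases hc0 : c = 0
      · exact mem_adjoin_of_capelli_eq_zero (by rw [hc, hc0, zero_smul])
      · have h := two_mul_capelli hp.1
        rw [hc, two_mul, ← two_smul K, smul_smul] at h
        refine ((Subalgebra.toSubmodule _).smul_mem_iff
          (mul_ne_zero (two_ne_zero (α := K)) hc0)).1 ?_
        rw [h]
        exact sum_mem fun i _ => sum_mem fun j _ => Subalgebra.mul_mem _
          (Algebra.subset_adjoin (Or.inr ⟨i, j, rfl⟩)) (ih (hcay hp i j))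

end Nowicki

section FreeMetabelian

open MvPolynomial

variable {K : Type*} [Field K] {d : ℕ}

/-- The generators of the free metabelian Lie algebra, as a single family. -/
def genL (K : Type*) [Field K] {d : ℕ} (z : Fin d ⊕ Fin d) : FreeMetabelian K d :=
  LieSubmodule.Quotient.mk' _ (FreeLieAlgebra.of K z)

lemma genL_inl (i : Fin d) : genL K (Sum.inl i) = xL K d i := rfl

lemma genL_inr (i : Fin d) : genL K (Sum.inr i) = yL K d i := rfl

/-- The commutator ideal of the free metabelian Lie algebra. -/
abbrev derivedIdeal (K : Type*) [Field K] (d : ℕ) : LieIdeal K (FreeMetabelian K d) :=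
  LieAlgebra.derivedSeries K (FreeMetabelian K d) 1

lemma lie_mem_derived (a b : FreeMetabelian K d) : ⁅a, b⁆ ∈ derivedIdeal K d :=
  LieSubmodule.lie_mem_lie (LieSubmodule.mem_top a) (LieSubmodule.mem_top b)

/-- The projection from the free Lie algebra, as a homomorphism of Lie algebras. -/
def toFreeMetabelian (K : Type*) [Field K] (d : ℕ) :
    FreeLieAlgebra K (Fin d ⊕ Fin d) →ₗ⁅K⁆ FreeMetabelian K d where
  toLinearMap := (LieSubmodule.Quotient.mk'
    (LieAlgebra.derivedSeries K (FreeLieAlgebra K (Fin d ⊕ Fin d)) 2) : _ →ₗ[K] _)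
  map_lie' := by
    intro x y
    exact LieSubmodule.Quotient.mk_bracket _ x y

lemma toFreeMetabelian_surjective : Function.Surjective (toFreeMetabelian K d) :=
  LieSubmodule.Quotient.surjective_mk' _

lemma toFreeMetabelian_of (z : Fin d ⊕ Fin d) :
    toFreeMetabelian K d (FreeLieAlgebra.of K z) = genL K z := rfl

lemma derivedSeries_two : LieAlgebra.derivedSeries K (FreeMetabelian K d) 2 = ⊥ := by
  rw [← LieIdeal.derivedSeries_map_eq (f := toFreeMetabelian K d) 2 toFreeMetabelian_surjective,
    eq_bot_iff, LieIdeal.map_le_iff_le_comap]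
  intro x hx
  rw [LieIdeal.mem_comap, LieSubmodule.mem_bot]
  exact (LieSubmodule.Quotient.mk_eq_zero _).2 hx

lemma lie_eq_zero_of_mem_derived {m n : FreeMetabelian K d} (hm : m ∈ derivedIdeal K d) (hn : n ∈ derivedIdeal K d) :
    ⁅m, n⁆ = 0 := by
  have h : ⁅m, n⁆ ∈ LieAlgebra.derivedSeries K (FreeMetabelian K d) 2 :=
    LieSubmodule.lie_mem_lie hm hn
  rwa [derivedSeries_two, LieSubmodule.mem_bot] at h

lemma lie_lie_comm {m : FreeMetabelian K d} (hm : m ∈ derivedIdeal K d) (a b : FreeMetabelian K d) :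
    ⁅⁅m, a⁆, b⁆ = ⁅⁅m, b⁆, a⁆ := by
  have h := lie_eq_zero_of_mem_derived hm (lie_mem_derived a b)
  rw [leibniz_lie, ← lie_skew a ⁅m, b⁆] at h
  exact sub_eq_zero.1 (by rw [sub_eq_add_neg]; exact h)

lemma subalgebra_eq_top {H : LieSubalgebra K (FreeMetabelian K d)} (hH : ∀ z, genL K z ∈ H)
    (w : FreeMetabelian K d) : w ∈ H := by
  obtain ⟨u, rfl⟩ := toFreeMetabelian_surjective w
  have h : H.incl.comp (FreeLieAlgebra.lift K fun z => (⟨genL K z, hH z⟩ : H)) =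
      toFreeMetabelian K d := by
    refine FreeLieAlgebra.hom_ext fun z => ?_
    simp [toFreeMetabelian_of]
  rw [← h]
  exact Subtype.property _

/-- A subspace containing the commutators of generators and closed under bracketing with
generators contains the commutator ideal. -/
lemma derived_le {T : Submodule K (FreeMetabelian K d)}
    (hgen : ∀ z w, ⁅(genL K z : FreeMetabelian K d), genL K w⁆ ∈ T)
    (hlie : ∀ m ∈ T, ∀ z, ⁅m, genL K z⁆ ∈ T) {m : FreeMetabelian K d} (hm : m ∈ derivedIdeal K d) : m ∈ T := by
  have ideal (t : FreeMetabelian K d) (ht : t ∈ T) (a : FreeMetabelian K d) : ⁅t, a⁆ ∈ T := by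
    let H : LieSubalgebra K (FreeMetabelian K d) :=
      { carrier := {a | ∀ t ∈ T, ⁅t, a⁆ ∈ T}
        add_mem' := fun ha hb t ht => by rw [lie_add]; exact add_mem (ha t ht) (hb t ht)
        zero_mem' := fun t _ => by simp
        smul_mem' := fun c a ha t ht => by rw [lie_smul]; exact T.smul_mem c (ha t ht)
        lie_mem' := fun {a b} ha hb t ht => by
          rw [leibniz_lie, ← lie_skew a]
          exact add_mem (hb _ (ha t ht)) (neg_mem (ha _ (hb t ht))) }
    exact subalgebra_eq_top (H := H) (fun z t ht => hlie t ht z) a t ht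
  have ideal' (t : FreeMetabelian K d) (ht : t ∈ T) (a : FreeMetabelian K d) : ⁅a, t⁆ ∈ T := by
    rw [← lie_skew]; exact neg_mem (ideal t ht a)
  have key (z : Fin d ⊕ Fin d) (a : FreeMetabelian K d) : ⁅a, genL K z⁆ ∈ T := by
    let H : LieSubalgebra K (FreeMetabelian K d) :=
      { carrier := {a | ⁅a, genL K z⁆ ∈ T}
        add_mem' := fun ha hb => by
          rw [Set.mem_ofPred_eq, add_lie]; exact add_mem ha hb
        zero_mem' := by simp
        smul_mem' := fun c a ha => by
          rw [Set.mem_ofPred_eq, smul_lie]; exact T.smul_mem c ha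
        lie_mem' := fun {a b} ha hb => by
          change ⁅⁅a, b⁆, _⁆ ∈ T
          rw [lie_lie]
          exact sub_mem (ideal' _ hb _) (ideal' _ ha _) }
    exact subalgebra_eq_top (H := H) (fun w => hgen w z) a
  have key' (a b : FreeMetabelian K d) : ⁅a, b⁆ ∈ T := by
    let H : LieSubalgebra K (FreeMetabelian K d) :=
      { carrier := {b : FreeMetabelian K d | ∀ a : FreeMetabelian K d, ⁅a, b⁆ ∈ T}
        add_mem' := fun ha hb t => by rw [lie_add]; exact add_mem (ha t) (hb t)
        zero_mem' := fun t => by simp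
        smul_mem' := fun c a ha t => by rw [lie_smul]; exact T.smul_mem c (ha t)
        lie_mem' := fun {a b} ha hb t => by
          rw [leibniz_lie]
          exact add_mem (hb _) (ideal' _ (hb _) _) }
    exact subalgebra_eq_top (H := H) (fun z a => key z a) b a
  have h : m ∈ (⁅(⊤ : LieIdeal K (FreeMetabelian K d)), (⊤ : LieIdeal K (FreeMetabelian K d))⁆ :
    LieIdeal K (FreeMetabelian K d)) := hm
  rw [← LieSubmodule.mem_toSubmodule, LieSubmodule.lieIdeal_oper_eq_linear_span'] at h
  refine Submodule.span_le.2 ?_ h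
  rintro _ ⟨a, -, b, -, rfl⟩
  exact key' a b

open scoped IsMulCommutative in
/-- There is an action of the polynomial ring on the commutator ideal by adjoint operators. -/
lemma exists_action : ∃ ρ : MvPolynomial (Fin d ⊕ Fin d) K →ₐ[K] Module.End K (derivedIdeal K d),
    ∀ z (m : derivedIdeal K d), (ρ (X z) m : FreeMetabelian K d) = ⁅(m : FreeMetabelian K d), genL K z⁆ := by
  let A (z : Fin d ⊕ Fin d) : Module.End K (derivedIdeal K d) :=
    -LieModule.toEnd K (FreeMetabelian K d) (derivedIdeal K d) (genL K z)
  have hA (z : Fin d ⊕ Fin d) (m : derivedIdeal K d) :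
      (A z m : FreeMetabelian K d) = ⁅(m : FreeMetabelian K d), genL K z⁆ := by
    simp [A]
  have hcomm : ∀ a ∈ Set.range A, ∀ b ∈ Set.range A, a * b = b * a := by
    rintro _ ⟨z, rfl⟩ _ ⟨w, rfl⟩
    ext m
    simp only [Module.End.mul_apply, hA]
    exact lie_lie_comm m.2 _ _
  have := Algebra.isMulCommutative_adjoin K hcomm
  refine ⟨(Algebra.adjoin K (Set.range A)).val.comp
    (aeval fun z => ⟨A z, Algebra.subset_adjoin ⟨z, rfl⟩⟩), fun z m => ?_⟩
  rw [AlgHom.comp_apply, aeval_X]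
  exact hA z m

/-- The action of the polynomial ring on the commutator ideal by adjoint operators. -/
def polyAction (K : Type*) [Field K] (d : ℕ) :
    MvPolynomial (Fin d ⊕ Fin d) K →ₐ[K] Module.End K (derivedIdeal K d) :=
  exists_action.choose

lemma polyAction_X (z : Fin d ⊕ Fin d) (m : derivedIdeal K d) :
    (polyAction K d (X z) m : FreeMetabelian K d) = ⁅(m : FreeMetabelian K d), genL K z⁆ :=
  exists_action.choose_spec z m

/-- The polynomial ring in three copies of the variables `x₁,…,x_d,y₁,…,y_d`. -/
abbrev TripleRing (K : Type*) [Field K] (d : ℕ) :=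
  MvPolynomial ((Fin 3 × Fin d) ⊕ (Fin 3 × Fin d)) K

/-- The index of the variable `z` in the copy `c`. -/
def copyIdx (c : Fin 3) (z : Fin d ⊕ Fin d) : (Fin 3 × Fin d) ⊕ (Fin 3 × Fin d) :=
  Sum.map (Prod.mk c) (Prod.mk c) z

lemma copyIdx_inj {c c' : Fin 3} {z z' : Fin d ⊕ Fin d} :
    copyIdx c z = copyIdx c' z' ↔ c = c' ∧ z = z' := by
  cases z <;> cases z' <;> simp [copyIdx]

/-- The variable `z` of the copy `c`. -/
def copyVar (K : Type*) [Field K] (c : Fin 3) (z : Fin d ⊕ Fin d) : TripleRing K d :=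
  X (copyIdx c z)

/-- The evaluation sending the copy `0` to the variables and the other copies to zero. -/
def baseEval (K : Type*) [Field K] (d : ℕ) :
    TripleRing K d →ₐ[K] MvPolynomial (Fin d ⊕ Fin d) K :=
  aeval (Sum.elim (fun s => if s.1 = 0 then X (Sum.inl s.2) else 0)
    (fun s => if s.1 = 0 then X (Sum.inr s.2) else 0))

lemma baseEval_copyVar (c : Fin 3) (z : Fin d ⊕ Fin d) :
    baseEval K d (copyVar K c z) = if c = 0 then X z else 0 := by
  cases z <;> simp [baseEval, copyVar, copyIdx]

lemma pderiv_copyVar (c c' : Fin 3) (z w : Fin d ⊕ Fin d) :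
    pderiv (copyIdx c z) (copyVar K c' w) = if c = c' ∧ z = w then 1 else 0 := by
  rw [copyVar, pderiv_X, Pi.single_apply]
  exact if_congr (by rw [copyIdx_inj]; tauto) rfl rfl

/-- The linear map sending `f(v₀) v₁(z) v₂(w)` to the result of the action of `f` on the
commutator `[z, w]` and vanishing on all monomials of a different degree in `v₁` or `v₂`. -/
def commMap (K : Type*) [Field K] (d : ℕ) : TripleRing K d →ₗ[K] FreeMetabelian K d :=
  ∑ z, ∑ w, (derivedIdeal K d).toSubmodule.subtype ∘ₗ
    (polyAction K d).toLinearMap.flip ⟨⁅genL K z, genL K w⁆, lie_mem_derived _ _⟩ ∘ₗ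
    (baseEval K d).toLinearMap ∘ₗ (pderiv (copyIdx 1 z)).toLinearMap ∘ₗ
    (pderiv (copyIdx 2 w)).toLinearMap

lemma commMap_apply (p : TripleRing K d) : commMap K d p =
    ∑ z, ∑ w, ((polyAction K d (baseEval K d (pderiv (copyIdx 1 z) (pderiv (copyIdx 2 w) p)))
      ⟨⁅genL K z, genL K w⁆, lie_mem_derived _ _⟩ : derivedIdeal K d) :
      FreeMetabelian K d) := by
  simp [commMap]

lemma commMap_mem (p : TripleRing K d) : commMap K d p ∈ derivedIdeal K d := by
  rw [commMap_apply]
  exact sum_mem fun z _ => sum_mem fun w _ => Subtype.property _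

lemma commMap_base_mul (z : Fin d ⊕ Fin d) (p : TripleRing K d) :
    commMap K d (copyVar K 0 z * p) = ⁅commMap K d p, genL K z⁆ := by
  simp only [commMap_apply, sum_lie]
  refine Finset.sum_congr rfl fun a _ => Finset.sum_congr rfl fun b _ => ?_
  rw [← polyAction_X, ← Module.End.mul_apply, ← map_mul]
  simp [pderiv_copyVar, baseEval_copyVar]

lemma commMap_mul (z w : Fin d ⊕ Fin d) :
    commMap K d (copyVar K 1 z * copyVar K 2 w) = ⁅genL K z, genL K w⁆ := by
  rw [commMap_apply, Finset.sum_eq_single z, Finset.sum_eq_single w]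
  · simp [pderiv_copyVar]
  · intro b _ hb
    simp [pderiv_copyVar, hb]
  · simp
  · intro a _ ha
    refine Finset.sum_eq_zero fun b _ => ?_
    by_cases hb : b = w <;> simp [pderiv_copyVar, ha, hb]
  · simp

lemma commMap_one : commMap K d 1 = 0 := by
  simp [commMap_apply]

lemma commMap_copyVar_one (z : Fin d ⊕ Fin d) : commMap K d (copyVar K 1 z) = 0 := by
  simp [commMap_apply, pderiv_copyVar]

lemma commMap_copyVar_two (z : Fin d ⊕ Fin d) : commMap K d (copyVar K 2 z) = 0 := by
  rw [commMap_apply]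
  refine Finset.sum_eq_zero fun a _ => Finset.sum_eq_zero fun b _ => ?_
  by_cases hb : b = z <;> simp [pderiv_copyVar, hb]

/-- The ideal generated by the variables of the copy `c`. -/
def copyIdeal (K : Type*) [Field K] (d : ℕ) (c : Fin 3) : Ideal (TripleRing K d) :=
  Ideal.span (Set.range fun z => copyVar K c z)

lemma copyVar_mem_copyIdeal (c : Fin 3) (z : Fin d ⊕ Fin d) :
    copyVar K c z ∈ copyIdeal K d c :=
  Ideal.subset_span ⟨z, rfl⟩

lemma baseEval_pderiv_eq_zero {c : Fin 3} (hc : c ≠ 0) {p : TripleRing K d}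
    (hp : p ∈ copyIdeal K d c * copyIdeal K d c) (s) : baseEval K d (pderiv s p) = 0 := by
  have h0 : ∀ q ∈ copyIdeal K d c, baseEval K d q = 0 := by
    intro q hq
    have : copyIdeal K d c ≤ RingHom.ker (baseEval K d) := by
      rw [copyIdeal, Ideal.span_le]
      rintro _ ⟨z, rfl⟩
      simp [RingHom.mem_ker, baseEval_copyVar, hc]
    exact this hq
  refine Submodule.mul_induction_on hp (fun a ha b hb => ?_) fun a b ha hb => ?_
  · simp [h0 a ha, h0 b hb]
  · simp [ha, hb]

lemma pderiv_mem_copyIdeal_mul {c c' : Fin 3} (hc : c' ≠ c) {p : TripleRing K d}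
    (hp : p ∈ copyIdeal K d c * copyIdeal K d c) (w : Fin d ⊕ Fin d) :
    pderiv (copyIdx c' w) p ∈ copyIdeal K d c * copyIdeal K d c := by
  have h : ∀ q ∈ copyIdeal K d c, pderiv (copyIdx c' w) q ∈ copyIdeal K d c := by
    intro q hq
    refine Submodule.span_induction ?_ (by simp) (fun a b _ _ ha hb => ?_)
      (fun r a hra ha => ?_) hq
    · rintro _ ⟨z, rfl⟩
      simp [pderiv_copyVar, hc]
    · rw [map_add]
      exact add_mem ha hb
    · rw [smul_eq_mul, Derivation.leibniz]
      exact add_mem (Ideal.mul_mem_left _ _ ha) (Ideal.mul_mem_right _ _ hra)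
  refine Submodule.mul_induction_on hp (fun a ha b hb => ?_) fun a b ha hb => ?_
  · rw [Derivation.leibniz, smul_eq_mul, smul_eq_mul, mul_comm b]
    exact add_mem (Ideal.mul_mem_mul ha (h b hb)) (Ideal.mul_mem_mul (h a ha) hb)
  · rw [map_add]
    exact add_mem ha hb

lemma commMap_eq_zero {c : Fin 3} (hc : c ≠ 0) {p : TripleRing K d}
    (hp : p ∈ copyIdeal K d c * copyIdeal K d c) : commMap K d p = 0 := by
  rw [commMap_apply]
  refine Finset.sum_eq_zero fun a _ => Finset.sum_eq_zero fun b _ => ?_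
  by_cases h2 : (2 : Fin 3) = c
  · rw [pderiv_comm, baseEval_pderiv_eq_zero hc (pderiv_mem_copyIdeal_mul (by
      rw [← h2]; decide) hp a)]
    simp
  · rw [baseEval_pderiv_eq_zero hc (pderiv_mem_copyIdeal_mul h2 hp b)]
    simp

/-- The Lie algebra on `A × A` with the bracket `⁅(a, b), (c, e)⁆ = (0, b c - a e)`. -/
def MagnusAlg (A : Type*) := A × A

section MagnusAlg

variable {A : Type*} [CommRing A]

instance : AddCommGroup (MagnusAlg A) := inferInstanceAs (AddCommGroup (A × A))

/-- The element of the Magnus algebra with given components. -/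
def MagnusAlg.mk (a b : A) : MagnusAlg A := (a, b)

instance : LieRing (MagnusAlg A) where
  bracket p q := .mk 0 (p.2 * q.1 - p.1 * q.2)
  add_lie p q r := Prod.ext (add_zero 0).symm <| by
    change (p.2 + q.2) * r.1 - (p.1 + q.1) * r.2 =
      (p.2 * r.1 - p.1 * r.2) + (q.2 * r.1 - q.1 * r.2)
    ring
  lie_add p q r := Prod.ext (add_zero 0).symm <| by
    change p.2 * (q.1 + r.1) - p.1 * (q.2 + r.2) =
      (p.2 * q.1 - p.1 * q.2) + (p.2 * r.1 - p.1 * r.2)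
    ring
  lie_self p := Prod.ext rfl <| by
    change p.2 * p.1 - p.1 * p.2 = 0
    ring
  leibniz_lie p q r := Prod.ext (add_zero 0).symm <| by
    change p.2 * 0 - p.1 * (q.2 * r.1 - q.1 * r.2) =
      ((p.2 * q.1 - p.1 * q.2) * r.1 - 0 * r.2) + (q.2 * 0 - q.1 * (p.2 * r.1 - p.1 * r.2))
    ring

lemma MagnusAlg.lie_def (p q : MagnusAlg A) : ⁅p, q⁆ = .mk 0 (p.2 * q.1 - p.1 * q.2) := rfl

variable [Algebra K A]

instance : Module K (MagnusAlg A) := inferInstanceAs (Module K (A × A))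

instance : LieAlgebra K (MagnusAlg A) where
  lie_smul c p q := Prod.ext (smul_zero c).symm <| by
    change p.2 * (c • q.1) - p.1 * (c • q.2) = c • (p.2 * q.1 - p.1 * q.2)
    rw [mul_smul_comm, mul_smul_comm, smul_sub]

lemma MagnusAlg.lie_mem_derived_one {p : MagnusAlg A}
    (hp : p ∈ LieAlgebra.derivedSeries K (MagnusAlg A) 1) : p.1 = 0 := by
  have h : p ∈ (⁅(⊤ : LieIdeal K (MagnusAlg A)), (⊤ : LieIdeal K (MagnusAlg A))⁆ :
    LieIdeal K (MagnusAlg A)) := hp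
  rw [← LieSubmodule.mem_toSubmodule, LieSubmodule.lieIdeal_oper_eq_linear_span'] at h
  refine Submodule.span_induction ?_ rfl (fun a b _ _ ha hb => ?_) (fun c a _ ha => ?_) h
  · rintro _ ⟨a, -, b, -, rfl⟩
    rfl
  · exact (congrArg₂ (· + ·) ha hb).trans (add_zero 0)
  · exact (congrArg (c • ·) ha).trans (smul_zero c)

lemma MagnusAlg.derivedSeries_two : LieAlgebra.derivedSeries K (MagnusAlg A) 2 = ⊥ := by
  rw [eq_bot_iff]
  refine LieSubmodule.lieIdeal_oper_eq_span (I := LieAlgebra.derivedSeries K (MagnusAlg A) 1)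
    (N := LieAlgebra.derivedSeries K (MagnusAlg A) 1) |>.trans_le (LieSubmodule.lieSpan_le.2 ?_)
  rintro _ ⟨⟨a, ha⟩, ⟨b, hb⟩, rfl⟩
  change ⁅a, b⁆ = 0
  rw [MagnusAlg.lie_def, lie_mem_derived_one ha, lie_mem_derived_one hb]
  simp
  rfl

end MagnusAlg

/-- The Magnus homomorphism on the free Lie algebra. -/
def magnusLift (K : Type*) [Field K] (d : ℕ) :
    FreeLieAlgebra K (Fin d ⊕ Fin d) →ₗ⁅K⁆ MagnusAlg (TripleRing K d) :=
  FreeLieAlgebra.lift K fun z => .mk (copyVar K 0 z) (copyVar K 2 z)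

/-- The Magnus homomorphism on the free metabelian Lie algebra, as a linear map. -/
def magnus (K : Type*) [Field K] (d : ℕ) :
    FreeMetabelian K d →ₗ[K] MagnusAlg (TripleRing K d) :=
  (LieAlgebra.derivedSeries K (FreeLieAlgebra K (Fin d ⊕ Fin d)) 2).toSubmodule.liftQ
    (magnusLift K d : _ →ₗ[K] _) (by
      intro x hx
      have h := LieIdeal.derivedSeries_map_le (f := magnusLift K d) 2 (LieIdeal.mem_map hx)
      rw [MagnusAlg.derivedSeries_two, LieSubmodule.mem_bot] at h
      exact h)

lemma magnus_toFreeMetabelian (u : FreeLieAlgebra K (Fin d ⊕ Fin d)) :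
    magnus K d (toFreeMetabelian K d u) = magnusLift K d u := rfl

lemma magnus_genL (z : Fin d ⊕ Fin d) :
    magnus K d (genL K z) = .mk (copyVar K 0 z) (copyVar K 2 z) := by
  rw [← toFreeMetabelian_of, magnus_toFreeMetabelian, magnusLift, FreeLieAlgebra.lift_of_apply]

lemma magnus_lie (a b : FreeMetabelian K d) :
    magnus K d ⁅a, b⁆ = ⁅magnus K d a, magnus K d b⁆ := by
  obtain ⟨a, rfl⟩ := toFreeMetabelian_surjective a
  obtain ⟨b, rfl⟩ := toFreeMetabelian_surjective b
  rw [← LieHom.map_lie, magnus_toFreeMetabelian, LieHom.map_lie]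
  rfl

/-- The Magnus coordinate of an element of the free metabelian Lie algebra. -/
def magnusCoord (K : Type*) [Field K] (d : ℕ) : FreeMetabelian K d →ₗ[K] TripleRing K d :=
  (LinearMap.snd K (TripleRing K d) (TripleRing K d) : MagnusAlg (TripleRing K d) →ₗ[K] _) ∘ₗ
    magnus K d

lemma magnusCoord_gen (z w : Fin d ⊕ Fin d) : magnusCoord K d ⁅genL K z, genL K w⁆ =
    copyVar K 2 z * copyVar K 0 w - copyVar K 0 z * copyVar K 2 w := by
  change (magnus K d ⁅genL K z, genL K w⁆).2 = _
  rw [magnus_lie, magnus_genL, magnus_genL]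
  rfl

lemma magnus_fst_eq_zero {m : FreeMetabelian K d} (hm : m ∈ derivedIdeal K d) :
    (magnus K d m).1 = 0 := by
  have := derived_le (T := LinearMap.ker
    ((LinearMap.fst K (TripleRing K d) (TripleRing K d) : MagnusAlg (TripleRing K d) →ₗ[K] _) ∘ₗ
      magnus K d)) (fun z w => ?_) (fun m _ z => ?_) hm
  · exact this
  · change (magnus K d _).1 = 0
    rw [magnus_lie]
    rfl
  · change (magnus K d _).1 = 0
    rw [magnus_lie]
    rfl

lemma magnusCoord_lie {m : FreeMetabelian K d} (hm : m ∈ derivedIdeal K d) (z : Fin d ⊕ Fin d) :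
    magnusCoord K d ⁅m, genL K z⁆ = copyVar K 0 z * magnusCoord K d m := by
  change (magnus K d ⁅m, genL K z⁆).2 = _ * (magnus K d m).2
  rw [magnus_lie, magnus_genL]
  change (magnus K d m).2 * copyVar K 0 z - (magnus K d m).1 * _ = _
  rw [magnus_fst_eq_zero hm]
  ring

lemma magnusCoord_derivation {δ : LieDerivation K (FreeMetabelian K d) (FreeMetabelian K d)}
    (hx : ∀ i : Fin d, δ (xL K d i) = 0) (hy : ∀ i : Fin d, δ (yL K d i) = xL K d i)
    (m : FreeMetabelian K d) :
    magnusCoord K d (δ m) = shiftDer K (Fin 3 × Fin d) (magnusCoord K d m) := by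
  let H : LieSubalgebra K (FreeMetabelian K d) :=
    { carrier := {m | (magnus K d (δ m)).1 = shiftDer K (Fin 3 × Fin d) (magnus K d m).1 ∧
        (magnus K d (δ m)).2 = shiftDer K (Fin 3 × Fin d) (magnus K d m).2}
      add_mem' := fun {a b} ha hb => by
        simp only [Set.mem_ofPred_eq, map_add] at *
        constructor
        · refine (congrArg₂ (· + ·) ha.1 hb.1).trans (map_add _ _ _).symm
        · refine (congrArg₂ (· + ·) ha.2 hb.2).trans (map_add _ _ _).symm
      zero_mem' := by
        simp only [Set.mem_ofPred_eq, map_zero]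
        exact ⟨(map_zero _).symm, (map_zero _).symm⟩
      smul_mem' := fun c a ha => by
        simp only [Set.mem_ofPred_eq, map_smul] at *
        constructor
        · refine (congrArg (c • ·) ha.1).trans (Derivation.map_smul _ _ _).symm
        · refine (congrArg (c • ·) ha.2).trans (Derivation.map_smul _ _ _).symm
      lie_mem' := fun {a b} ha hb => by
        simp only [Set.mem_ofPred_eq, LieDerivation.apply_lie_eq_add, map_add, magnus_lie] at *
        constructor
        · exact (add_zero 0).trans (map_zero _).symm
        · change ((magnus K d a).2 * (magnus K d (δ b)).1 -
              (magnus K d a).1 * (magnus K d (δ b)).2) +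
            ((magnus K d (δ a)).2 * (magnus K d b).1 -
              (magnus K d (δ a)).1 * (magnus K d b).2) =
            shiftDer K (Fin 3 × Fin d) ((magnus K d a).2 * (magnus K d b).1 -
              (magnus K d a).1 * (magnus K d b).2)
          rw [ha.1, ha.2, hb.1, hb.2, map_sub, Derivation.leibniz, Derivation.leibniz]
          simp only [smul_eq_mul]
          ring }
  refine (subalgebra_eq_top (H := H) (fun z => ?_) m).2
  cases z with
  | inl i =>
    change (magnus K d (δ (xL K d i))).1 = shiftDer K (Fin 3 × Fin d) (magnus K d (genL K _)).1 ∧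
      (magnus K d (δ (xL K d i))).2 = shiftDer K (Fin 3 × Fin d) (magnus K d (genL K _)).2
    rw [hx, magnus_genL, map_zero]
    exact ⟨(shiftDer_X_inl _).symm, (shiftDer_X_inl _).symm⟩
  | inr i =>
    change (magnus K d (δ (yL K d i))).1 = shiftDer K (Fin 3 × Fin d) (magnus K d (genL K _)).1 ∧
      (magnus K d (δ (yL K d i))).2 = shiftDer K (Fin 3 × Fin d) (magnus K d (genL K _)).2
    rw [hy, ← genL_inl, magnus_genL, magnus_genL]
    exact ⟨(shiftDer_X_inr _).symm, (shiftDer_X_inr _).symm⟩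

/-- The derivation of the polynomial ring replacing the copy `0` by the copy `1`. -/
def polarize (K : Type*) [Field K] (d : ℕ) : Derivation K (TripleRing K d) (TripleRing K d) :=
  mkDerivation K (Sum.elim (fun s => if s.1 = 0 then copyVar K 1 (Sum.inl s.2) else 0)
    (fun s => if s.1 = 0 then copyVar K 1 (Sum.inr s.2) else 0))

lemma polarize_copyVar (c : Fin 3) (z : Fin d ⊕ Fin d) :
    polarize K d (copyVar K c z) = if c = 0 then copyVar K 1 z else 0 := by
  cases z <;> simp [polarize, copyVar, copyIdx]

lemma shiftDer_polarize (p : TripleRing K d) :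
    shiftDer K _ (polarize K d p) = polarize K d (shiftDer K _ p) := by
  have h : ⁅shiftDer K (Fin 3 × Fin d), polarize K d⁆ = 0 := by
    refine MvPolynomial.derivation_ext fun s => ?_
    rcases s with s | s <;>
      by_cases hs : s.1 = 0 <;>
        simp [Derivation.commutator_apply, polarize, hs, copyVar, copyIdx]
  have h' := congrArg (fun D => D p) h
  rwa [Derivation.commutator_apply, Derivation.zero_apply, sub_eq_zero] at h'

lemma commMap_one_mul_magnusCoord {m : FreeMetabelian K d} (hm : m ∈ derivedIdeal K d)
    (z : Fin d ⊕ Fin d) :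
    commMap K d (copyVar K 1 z * magnusCoord K d m) = -⁅m, genL K z⁆ := by
  have h := derived_le (T := (derivedIdeal K d).toSubmodule ⊓
    LinearMap.ker (commMap K d ∘ₗ LinearMap.mulLeft K (copyVar K 1 z) ∘ₗ magnusCoord K d -
      ((LieModule.toEnd K (FreeMetabelian K d) (FreeMetabelian K d) (genL K z)))))
    (fun a b => ?_) (fun m hm w => ?_) hm
  · have h2 := (Submodule.mem_inf.1 h).2
    rw [LinearMap.mem_ker, LinearMap.sub_apply, sub_eq_zero] at h2
    rw [lie_skew]
    exact h2
  · refine Submodule.mem_inf.2 ⟨lie_mem_derived _ _, ?_⟩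
    rw [LinearMap.mem_ker, LinearMap.sub_apply, sub_eq_zero]
    simp only [LinearMap.comp_apply, LinearMap.mulLeft_apply, magnusCoord_gen,
      LieModule.toEnd_apply_apply]
    rw [mul_sub, show copyVar K 1 z * (copyVar K 2 a * copyVar K 0 b) =
        copyVar K 0 b * (copyVar K 1 z * copyVar K 2 a) by ring,
      show copyVar K 1 z * (copyVar K 0 a * copyVar K 2 b) =
        copyVar K 0 a * (copyVar K 1 z * copyVar K 2 b) by ring, map_sub,
      commMap_base_mul, commMap_base_mul, commMap_mul, commMap_mul, leibniz_lie,
      ← lie_skew (genL K a) ⁅genL K z, genL K b⁆]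
    abel
  · obtain ⟨hm, h2⟩ := Submodule.mem_inf.1 hm
    refine Submodule.mem_inf.2 ⟨lie_mem_derived _ _, ?_⟩
    rw [LinearMap.mem_ker, LinearMap.sub_apply, sub_eq_zero] at h2 ⊢
    simp only [LinearMap.comp_apply, LinearMap.mulLeft_apply,
      LieModule.toEnd_apply_apply] at h2 ⊢
    rw [magnusCoord_lie hm, mul_left_comm, commMap_base_mul, h2,
      ← lie_skew (genL K z) m, neg_lie, lie_lie_comm hm, lie_skew]

/-- A degree operator on the free metabelian Lie algebra. -/
def degreeOp (K : Type*) [Field K] (d : ℕ) : Module.End K (FreeMetabelian K d) :=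
  -(commMap K d ∘ₗ (polarize K d).toLinearMap ∘ₗ magnusCoord K d)

lemma degreeOp_apply (m : FreeMetabelian K d) :
    degreeOp K d m = -commMap K d (polarize K d (magnusCoord K d m)) := rfl

lemma degreeOp_gen (a b : Fin d ⊕ Fin d) :
    degreeOp K d ⁅genL K a, genL K b⁆ = (2 : K) • ⁅genL K a, genL K b⁆ := by
  rw [degreeOp_apply, magnusCoord_gen, map_sub, Derivation.leibniz, Derivation.leibniz]
  simp only [polarize_copyVar, smul_eq_mul, if_true, Fin.reduceEq, if_false, mul_zero, add_zero,
    zero_add]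
  rw [mul_comm, mul_comm (copyVar K 2 b), map_sub, commMap_mul, commMap_mul, ← lie_skew, two_smul]
  abel

lemma degreeOp_lie {m : FreeMetabelian K d} (hm : m ∈ derivedIdeal K d) (z : Fin d ⊕ Fin d) :
    degreeOp K d ⁅m, genL K z⁆ = ⁅degreeOp K d m, genL K z⁆ + ⁅m, genL K z⁆ := by
  rw [degreeOp_apply, magnusCoord_lie hm, Derivation.leibniz, polarize_copyVar, if_pos rfl,
    smul_eq_mul, smul_eq_mul, mul_comm (magnusCoord K d m), map_add, commMap_base_mul,
    commMap_one_mul_magnusCoord hm, degreeOp_apply, neg_lie]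
  abel

lemma derivedIdeal_le_iSup {m : FreeMetabelian K d} (hm : m ∈ derivedIdeal K d) :
    m ∈ ⨆ k : ℕ, (degreeOp K d).eigenspace ((k : K) + 2) := by
  have h := derived_le (T := ⨆ k : ℕ, (derivedIdeal K d).toSubmodule ⊓
    (degreeOp K d).eigenspace ((k : K) + 2)) (fun a b => ?_) (fun m hm z => ?_) hm
  · have hle : (⨆ k : ℕ, (derivedIdeal K d).toSubmodule ⊓
        (degreeOp K d).eigenspace ((k : K) + 2)) ≤
        ⨆ k : ℕ, (degreeOp K d).eigenspace ((k : K) + 2) := iSup_mono fun _ => inf_le_right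
    exact hle h
  · refine Submodule.mem_iSup_of_mem 0 (Submodule.mem_inf.2 ⟨lie_mem_derived _ _, ?_⟩)
    rw [Module.End.mem_eigenspace_iff, degreeOp_gen, Nat.cast_zero, zero_add]
  · induction hm using Submodule.iSup_induction' with
    | mem k m hm =>
      obtain ⟨hm, h2⟩ := Submodule.mem_inf.1 hm
      refine Submodule.mem_iSup_of_mem (k + 1) (Submodule.mem_inf.2 ⟨lie_mem_derived _ _, ?_⟩)
      rw [Module.End.mem_eigenspace_iff] at h2 ⊢
      rw [degreeOp_lie hm, h2, smul_lie, Nat.cast_add, Nat.cast_one]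
      module
    | zero => simp
    | add a b _ _ ha hb =>
      rw [add_lie]
      exact add_mem ha hb

lemma eq_zero_of_degreeOp_eq_zero [CharZero K] {m : FreeMetabelian K d}
    (hm : m ∈ derivedIdeal K d) (h0 : degreeOp K d m = 0) : m = 0 := by
  have hdis := (degreeOp K d).eigenspaces_iSupIndep 0
  rw [Submodule.disjoint_def] at hdis
  refine hdis m (by rw [Module.End.mem_eigenspace_iff, h0, zero_smul]) ?_
  refine (iSup_le fun k : ℕ => ?_ : ⨆ k : ℕ, (degreeOp K d).eigenspace ((k : K) + 2) ≤ _)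
    (derivedIdeal_le_iSup hm)
  exact le_iSup₂_of_le ((k : K) + 2) (by norm_cast) le_rfl

/-- A subspace containing the given constants and closed under the operators realizing the action
of the algebra of constants. -/
structure IsConstantSubmodule (V : Submodule K (FreeMetabelian K d)) : Prop where
  gset_subset : Gset K d ⊆ (V : Set (FreeMetabelian K d))
  lie_x_mem : ∀ w ∈ V, ∀ i, ⁅w, xL K d i⁆ ∈ V
  lie_minor_mem : ∀ w ∈ V, ∀ p q : Fin d, p < q →
    ⁅⁅w, xL K d p⁆, yL K d q⁆ - ⁅⁅w, xL K d q⁆, yL K d p⁆ ∈ V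

lemma lie_lie_sub (a b c : FreeMetabelian K d) : ⁅⁅a, b⁆, c⁆ - ⁅⁅a, c⁆, b⁆ = -⁅⁅b, c⁆, a⁆ := by
  rw [lie_skew, leibniz_lie a b c, ← lie_skew b ⁅a, c⁆]
  abel

/-- The Lie element corresponding to `(x_k y₁ᵢ - x₁ᵢ y_k) (x_l y₂ⱼ - x₂ⱼ y_l)`. -/
def quarticElt (K : Type*) [Field K] {d : ℕ} (i j k l : Fin d) : FreeMetabelian K d :=
  ⁅⁅⁅xL K d i, xL K d j⁆, yL K d k⁆, yL K d l⁆ + ⁅⁅⁅yL K d i, yL K d j⁆, xL K d k⁆, xL K d l⁆ -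
    ⁅⁅⁅xL K d i, yL K d j⁆, yL K d k⁆, xL K d l⁆ - ⁅⁅⁅yL K d i, xL K d j⁆, xL K d k⁆, yL K d l⁆

lemma quarticElt_swap (i j k l : Fin d) : quarticElt K i j k l = -quarticElt K j i l k := by
  have comm (a b c e : FreeMetabelian K d) : ⁅⁅⁅a, b⁆, c⁆, e⁆ = -⁅⁅⁅b, a⁆, e⁆, c⁆ := by
    rw [lie_lie_comm (lie_mem_derived a b), ← lie_skew a b, neg_lie, neg_lie]
  rw [quarticElt, quarticElt, comm, comm (yL K d i), comm (xL K d i), comm (yL K d i)]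
  abel

lemma quarticElt_add (i j k l : Fin d) : quarticElt K i j k l + quarticElt K k j i l =
    ⁅⁅⁅xL K d i, yL K d k⁆ + ⁅xL K d k, yL K d i⁆, xL K d j⁆, yL K d l⁆ -
      ⁅⁅⁅xL K d i, yL K d k⁆ + ⁅xL K d k, yL K d i⁆, xL K d l⁆, yL K d j⁆ := by
  have jac (a b c e : FreeMetabelian K d) :
      ⁅⁅⁅a, b⁆, c⁆, e⁆ = ⁅⁅⁅a, c⁆, b⁆, e⁆ + ⁅⁅⁅c, b⁆, a⁆, e⁆ := by
    rw [← add_lie, ← lie_skew c b, neg_lie, ← lie_lie_sub a b c]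
    congr 1
    abel
  simp only [quarticElt, add_lie]
  rw [jac (xL K d i) (xL K d j), jac (xL K d i) (yL K d j), jac (xL K d k) (xL K d j),
    jac (xL K d k) (yL K d j),
    lie_lie_comm (lie_mem_derived (xL K d i) (yL K d k)) (xL K d l),
    lie_lie_comm (lie_mem_derived (xL K d k) (yL K d i)) (xL K d l)]
  abel

namespace IsConstantSubmodule

variable {V : Submodule K (FreeMetabelian K d)}

lemma lie_minor_mem' (hV : IsConstantSubmodule V) {w : FreeMetabelian K d} (hw : w ∈ V)
    (p q : Fin d) : ⁅⁅w, xL K d p⁆, yL K d q⁆ - ⁅⁅w, xL K d q⁆, yL K d p⁆ ∈ V := by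
  rcases lt_trichotomy p q with h | rfl | h
  · exact hV.lie_minor_mem w hw p q h
  · simp
  · rw [← neg_sub]
    exact neg_mem (hV.lie_minor_mem w hw q p h)

lemma lie_x_x_mem (hV : IsConstantSubmodule V) (i j : Fin d) : ⁅xL K d i, xL K d j⁆ ∈ V := by
  have h (i j : Fin d) (hij : i < j) : ⁅xL K d i, xL K d j⁆ ∈ V := by
    refine hV.gset_subset ?_
    simp only [Gset, Set.mem_union]
    exact .inl (.inl (.inl (.inl (.inr ⟨i, j, hij, rfl⟩))))
  rcases lt_trichotomy i j with hij | rfl | hij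
  · exact h i j hij
  · simp
  · rw [← lie_skew]
    exact neg_mem (h j i hij)

lemma lie_x_y_add_mem (hV : IsConstantSubmodule V) (i j : Fin d) :
    ⁅xL K d i, yL K d j⁆ + ⁅xL K d j, yL K d i⁆ ∈ V := by
  have h (i j : Fin d) (hij : i < j) : ⁅xL K d i, yL K d j⁆ + ⁅xL K d j, yL K d i⁆ ∈ V := by
    refine hV.gset_subset ?_
    simp only [Gset, Set.mem_union]
    exact .inl (.inl (.inl (.inr ⟨i, j, hij, rfl⟩)))
  rcases lt_trichotomy i j with hij | rfl | hij
  · exact h i j hij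
  · have h1 : ⁅xL K d i, yL K d i⁆ ∈ V := by
      refine hV.gset_subset ?_
      simp only [Gset, Set.mem_union]
      exact .inl (.inl (.inl (.inl (.inl ⟨i, rfl⟩))))
    exact add_mem h1 h1
  · rw [add_comm]
    exact h j i hij

variable [CharZero K]

lemma mem_of_add_self_mem {w : FreeMetabelian K d} (h : w + w ∈ V) : w ∈ V := by
  rw [← two_smul K] at h
  exact (V.smul_mem_iff two_ne_zero).1 h

lemma cubic_mem (hV : IsConstantSubmodule V) (i j k : Fin d) :
    ⁅⁅xL K d i, xL K d j⁆, yL K d k⁆ - ⁅⁅xL K d i, yL K d j⁆, xL K d k⁆ ∈ V := by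
  have h (i j k : Fin d) (hjk : j < k) :
      ⁅⁅xL K d i, xL K d j⁆, yL K d k⁆ - ⁅⁅xL K d i, yL K d j⁆, xL K d k⁆ ∈ V := by
    refine hV.gset_subset ?_
    simp only [Gset, Set.mem_union]
    exact .inl (.inl (.inr ⟨i, j, k, hjk, rfl⟩))
  have hadd : (⁅⁅xL K d i, xL K d j⁆, yL K d k⁆ - ⁅⁅xL K d i, yL K d j⁆, xL K d k⁆) +
      (⁅⁅xL K d i, xL K d k⁆, yL K d j⁆ - ⁅⁅xL K d i, yL K d k⁆, xL K d j⁆) ∈ V := by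
    have h1 := hV.lie_x_mem _ (hV.lie_x_y_add_mem j k) i
    rw [add_lie] at h1
    have h2 := lie_lie_sub (xL K d i) (xL K d j) (yL K d k)
    have h3 := lie_lie_sub (xL K d i) (xL K d k) (yL K d j)
    convert neg_mem h1 using 1
    rw [neg_add, ← h2, ← h3]
    abel
  rcases lt_trichotomy j k with hjk | rfl | hjk
  · exact h i j k hjk
  · exact mem_of_add_self_mem hadd
  · exact (V.add_mem_iff_left (h i k j hjk)).1 hadd

lemma quarticElt_mem (hV : IsConstantSubmodule V) (i j k l : Fin d) :
    quarticElt K i j k l ∈ V := by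
  have hadd (i j k l : Fin d) : quarticElt K i j k l + quarticElt K k j i l ∈ V := by
    rw [quarticElt_add]
    exact hV.lie_minor_mem' (hV.lie_x_y_add_mem i k) j l
  have reduce (j l : Fin d) (h : ∀ i k : Fin d, i < k → quarticElt K i j k l ∈ V) (i k : Fin d) :
      quarticElt K i j k l ∈ V := by
    rcases lt_trichotomy i k with hik | rfl | hik
    · exact h i k hik
    · exact mem_of_add_self_mem (hadd i j i l)
    · exact (V.add_mem_iff_left (h k i hik)).1 (hadd i j k l)
  refine reduce j l (fun i k hik => ?_) i k
  rw [quarticElt_swap]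
  refine neg_mem (reduce i k (fun j l hjl => ?_) j l)
  rw [quarticElt_swap]
  refine neg_mem (hV.gset_subset ?_)
  simp only [Gset, Set.mem_union]
  exact .inr ⟨i, k, j, l, hik, hjl, rfl⟩

end IsConstantSubmodule

/-- The variables and minors of the copies `0` and `c` which are linear in the copy `c`. -/
inductive LinearFactor (K : Type*) [Field K] {d : ℕ} (c : Fin 3) : TripleRing K d → Prop
  | var (i : Fin d) : LinearFactor K c (copyVar K c (Sum.inl i))
  | minor (k i : Fin d) : LinearFactor K c (minor K (0, k) (c, i))

/-- The products of the generating variables and minors, without factors from the copy `0`, of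
degree at most one in each of the copies `1` and `2`. -/
inductive MultilinearFactor (K : Type*) [Field K] {d : ℕ} : TripleRing K d → Prop
  | one : MultilinearFactor K 1
  | left {p : TripleRing K d} (hp : LinearFactor K 1 p) : MultilinearFactor K p
  | right {p : TripleRing K d} (hp : LinearFactor K 2 p) : MultilinearFactor K p
  | mul {p q : TripleRing K d} (hp : LinearFactor K 1 p) (hq : LinearFactor K 2 q) :
      MultilinearFactor K (p * q)
  | minor (i j : Fin d) : MultilinearFactor K (minor K (1, i) (2, j))

lemma minor_eq (c c' : Fin 3) (i j : Fin d) : minor K (c, i) (c', j) =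
    copyVar K c (Sum.inl i) * copyVar K c' (Sum.inr j) -
      copyVar K c' (Sum.inl j) * copyVar K c (Sum.inr i) := rfl

lemma minor_mem_left (c c' : Fin 3) (i j : Fin d) :
    minor K (c, i) (c', j) ∈ copyIdeal K d c := by
  rw [minor_eq]
  exact sub_mem (Ideal.mul_mem_right _ _ (copyVar_mem_copyIdeal _ _))
    (Ideal.mul_mem_left _ _ (copyVar_mem_copyIdeal _ _))

lemma minor_mem_right (c c' : Fin 3) (i j : Fin d) :
    minor K (c, i) (c', j) ∈ copyIdeal K d c' := by
  rw [minor_eq]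
  exact sub_mem (Ideal.mul_mem_left _ _ (copyVar_mem_copyIdeal _ _))
    (Ideal.mul_mem_right _ _ (copyVar_mem_copyIdeal _ _))

lemma LinearFactor.mem_copyIdeal {c : Fin 3} {p : TripleRing K d} (hp : LinearFactor K c p) :
    p ∈ copyIdeal K d c := by
  cases hp with
  | var i => exact copyVar_mem_copyIdeal _ _
  | minor k i => exact minor_mem_right _ _ _ _

lemma minor_mem_mul (c : Fin 3) (i j : Fin d) :
    minor K (c, i) (c, j) ∈ copyIdeal K d c * copyIdeal K d c := by
  rw [minor_eq]
  exact sub_mem (Ideal.mul_mem_mul (copyVar_mem_copyIdeal _ _) (copyVar_mem_copyIdeal _ _))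
    (Ideal.mul_mem_mul (copyVar_mem_copyIdeal _ _) (copyVar_mem_copyIdeal _ _))

lemma minor_comm {J : Type*} (a b : J) : minor K b a = -minor K a b := by
  simp [minor]

namespace MultilinearFactor

variable {t g : TripleRing K d}

lemma mul_left (ht : MultilinearFactor K t) (hg : LinearFactor K 1 g) :
    MultilinearFactor K (t * g) ∨
      ∃ c : Fin 3, c ≠ 0 ∧ t * g ∈ copyIdeal K d c * copyIdeal K d c := by
  have key (h : t ∈ copyIdeal K d 1) : MultilinearFactor K (t * g) ∨
      ∃ c : Fin 3, c ≠ 0 ∧ t * g ∈ copyIdeal K d c * copyIdeal K d c :=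
    .inr ⟨1, by decide, Ideal.mul_mem_mul h hg.mem_copyIdeal⟩
  cases ht with
  | one => exact .inl (by rw [one_mul]; exact .left hg)
  | left hp => exact key hp.mem_copyIdeal
  | right hp => exact .inl (by rw [mul_comm]; exact .mul hg hp)
  | mul hp hq => exact key (Ideal.mul_mem_right _ _ hp.mem_copyIdeal)
  | minor i j => exact key (minor_mem_left _ _ _ _)

lemma mul_right (ht : MultilinearFactor K t) (hg : LinearFactor K 2 g) :
    MultilinearFactor K (t * g) ∨
      ∃ c : Fin 3, c ≠ 0 ∧ t * g ∈ copyIdeal K d c * copyIdeal K d c := by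
  have key (h : t ∈ copyIdeal K d 2) : MultilinearFactor K (t * g) ∨
      ∃ c : Fin 3, c ≠ 0 ∧ t * g ∈ copyIdeal K d c * copyIdeal K d c :=
    .inr ⟨2, by decide, Ideal.mul_mem_mul h hg.mem_copyIdeal⟩
  cases ht with
  | one => exact .inl (by rw [one_mul]; exact .right hg)
  | left hp => exact .inl (.mul hp hg)
  | right hp => exact key hp.mem_copyIdeal
  | mul hp hq => exact key (Ideal.mul_mem_left _ _ hq.mem_copyIdeal)
  | minor i j => exact key (minor_mem_right _ _ _ _)

lemma mul_minor (ht : MultilinearFactor K t) (i j : Fin d) :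
    MultilinearFactor K (t * _root_.minor K (1, i) (2, j)) ∨
      ∃ c : Fin 3, c ≠ 0 ∧
        t * _root_.minor K (1, i) (2, j) ∈ copyIdeal K d c * copyIdeal K d c := by
  have key (c : Fin 3) (hc : c = 1 ∨ c = 2) (h : t ∈ copyIdeal K d c) :
      t * _root_.minor K (1, i) (2, j) ∈ copyIdeal K d c * copyIdeal K d c := by
    refine Ideal.mul_mem_mul h ?_
    rcases hc with rfl | rfl
    · exact minor_mem_left _ _ _ _
    · exact minor_mem_right _ _ _ _
  cases ht with
  | one => exact .inl (by rw [one_mul]; exact .minor i j)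
  | left hp => exact .inr ⟨1, by decide, key 1 (.inl rfl) hp.mem_copyIdeal⟩
  | right hp => exact .inr ⟨2, by decide, key 2 (.inr rfl) hp.mem_copyIdeal⟩
  | mul hp hq =>
    exact .inr ⟨1, by decide, key 1 (.inl rfl) (Ideal.mul_mem_right _ _ hp.mem_copyIdeal)⟩
  | minor k l => exact .inr ⟨1, by decide, key 1 (.inl rfl) (minor_mem_left _ _ _ _)⟩

end MultilinearFactor

lemma LinearFactor.commMap_eq_zero {c : Fin 3} (hc : c = 1 ∨ c = 2) {p : TripleRing K d}
    (hp : LinearFactor K c p) : commMap K d p = 0 := by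
  have h0 (z) : commMap K d (copyVar K c z) = 0 := by
    rcases hc with rfl | rfl
    · exact commMap_copyVar_one z
    · exact commMap_copyVar_two z
  cases hp with
  | var i => exact h0 _
  | minor k i =>
    rw [minor_eq, mul_comm (copyVar K c _), map_sub, commMap_base_mul, commMap_base_mul, h0, h0]
    simp

namespace IsConstantSubmodule

variable {V : Submodule K (FreeMetabelian K d)}

lemma commMap_mem_of_multilinearFactor [CharZero K] (hV : IsConstantSubmodule V)
    {p : TripleRing K d} (hp : MultilinearFactor K p) : commMap K d p ∈ V := by
  cases hp with
  | one => rw [commMap_one]; exact zero_mem V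
  | left hp => rw [hp.commMap_eq_zero (.inl rfl)]; exact zero_mem V
  | right hp => rw [hp.commMap_eq_zero (.inr rfl)]; exact zero_mem V
  | minor i j =>
    rw [minor_eq, mul_comm (copyVar K 2 _), map_sub, commMap_mul, commMap_mul, genL_inl, genL_inl,
      genL_inr, genL_inr, ← lie_skew (yL K d i), sub_neg_eq_add]
    exact hV.lie_x_y_add_mem i j
  | mul hp hq =>
    cases hp with
    | var i =>
      cases hq with
      | var j =>
        rw [commMap_mul]
        exact hV.lie_x_x_mem i j
      | minor k j =>
        rw [minor_eq, show ∀ a b c e f : TripleRing K d,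
          a * (b * c - e * f) = b * (a * c) - f * (a * e) by intros; ring, map_sub,
          commMap_base_mul, commMap_base_mul, commMap_mul, commMap_mul, ← neg_sub]
        exact neg_mem (hV.cubic_mem i j k)
    | minor k i =>
      cases hq with
      | var j =>
        rw [minor_eq, show ∀ a b c e f : TripleRing K d,
          (b * c - e * f) * a = b * (c * a) - f * (e * a) by intros; ring, map_sub,
          commMap_base_mul, commMap_base_mul, commMap_mul, commMap_mul,
          ← lie_skew (genL K (Sum.inr i)), ← lie_skew (genL K (Sum.inl i)), neg_lie, neg_lie,
          neg_sub_neg]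
        exact hV.cubic_mem j i k
      | minor l j =>
        rw [minor_eq, minor_eq, show ∀ a b c e f g h k : TripleRing K d,
          (a * b - c * e) * (f * g - h * k) = k * (e * (c * h)) + f * (a * (b * g)) -
            f * (e * (c * g)) - k * (a * (b * h)) by intros; ring]
        simp only [map_sub, map_add, commMap_base_mul, commMap_mul]
        exact hV.quarticElt_mem i j k l

lemma commMap_base_minor_mul_mem (hV : IsConstantSubmodule V) {p : TripleRing K d}
    (hp : commMap K d p ∈ V) (i j : Fin d) :
    commMap K d (minor K (0, i) (0, j) * p) ∈ V := by
  rw [minor_eq, show ∀ a b c e : TripleRing K d, (a * b - c * e) * p =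
    b * (a * p) - e * (c * p) by intros; ring, map_sub]
  simp only [commMap_base_mul]
  exact hV.lie_minor_mem' hp i j

lemma commMap_mem [CharZero K] (hV : IsConstantSubmodule V) {p : TripleRing K d}
    (hp : p ∈ Algebra.adjoin K (nowickiGenerators K (Fin 3 × Fin d))) : commMap K d p ∈ V := by
  let M : Submodule K (TripleRing K d) :=
    { carrier := {q | ∀ t, MultilinearFactor K t → commMap K d (t * q) ∈ V}
      add_mem' := fun ha hb t ht => by
        rw [mul_add, map_add]
        exact add_mem (ha t ht) (hb t ht)
      zero_mem' := fun t _ => by simp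
      smul_mem' := fun c a ha t ht => by
        rw [mul_smul_comm, map_smul]
        exact V.smul_mem c (ha t ht) }
  have of_mul {g : TripleRing K d} (hg : ∀ t, MultilinearFactor K t →
      MultilinearFactor K (t * g) ∨
        ∃ c : Fin 3, c ≠ 0 ∧ t * g ∈ copyIdeal K d c * copyIdeal K d c) :
      ∀ q ∈ M, q * g ∈ M := by
    intro q hq t ht
    rw [mul_left_comm, mul_comm q]
    rcases hg t ht with h | ⟨c, hc, h⟩
    · exact hq _ h
    · rw [commMap_eq_zero hc (Ideal.mul_mem_right _ _ h)]
      exact zero_mem V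
  have base (j : Fin d) : ∀ q ∈ M, q * copyVar K 0 (Sum.inl j) ∈ M := by
    intro q hq t ht
    rw [← mul_assoc, mul_comm, commMap_base_mul]
    exact hV.lie_x_mem _ (hq t ht) j
  have baseMinor (i j : Fin d) : ∀ q ∈ M, q * minor K (0, i) (0, j) ∈ M := by
    intro q hq t ht
    rw [← mul_assoc, mul_comm]
    exact hV.commMap_base_minor_mul_mem (hq t ht) i j
  have minor_swap {a b : Fin 3 × Fin d} (h : ∀ q ∈ M, q * minor K a b ∈ M) :
      ∀ q ∈ M, q * minor K b a ∈ M := by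
    intro q hq
    rw [minor_comm, mul_neg]
    exact neg_mem (h q hq)
  have left {g : TripleRing K d} (hg : LinearFactor K 1 g) : ∀ q ∈ M, q * g ∈ M :=
    of_mul fun t ht => ht.mul_left hg
  have right {g : TripleRing K d} (hg : LinearFactor K 2 g) : ∀ q ∈ M, q * g ∈ M :=
    of_mul fun t ht => ht.mul_right hg
  have self {c : Fin 3} (hc : c ≠ 0) (i j : Fin d) : ∀ q ∈ M, q * minor K (c, i) (c, j) ∈ M :=
    of_mul fun t _ => .inr ⟨c, hc, Ideal.mul_mem_left _ _ (minor_mem_mul c i j)⟩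
  have mixed (i j : Fin d) : ∀ q ∈ M, q * minor K (1, i) (2, j) ∈ M :=
    of_mul fun t ht => ht.mul_minor i j
  have cases3 (c : Fin 3) : c = 0 ∨ c = 1 ∨ c = 2 := by fin_cases c <;> simp
  have gen : ∀ g ∈ nowickiGenerators K (Fin 3 × Fin d), ∀ q ∈ M, q * g ∈ M := by
    rintro _ (⟨⟨c, j⟩, rfl⟩ | ⟨⟨c, i⟩, ⟨c', j⟩, rfl⟩)
    · rcases cases3 c with rfl | rfl | rfl
      · exact base j
      · exact left (.var j)
      · exact right (.var j)
    · rcases cases3 c with rfl | rfl | rfl <;> rcases cases3 c' with rfl | rfl | rfl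
      · exact baseMinor i j
      · exact left (.minor i j)
      · exact right (.minor i j)
      · exact minor_swap (left (.minor j i))
      · exact self (by decide) i j
      · exact mixed i j
      · exact minor_swap (right (.minor j i))
      · exact minor_swap (mixed j i)
      · exact self (by decide) i j
  have all : ∀ q ∈ M, q * p ∈ M := by
    induction hp using Algebra.adjoin_induction with
    | mem g hg => exact gen g hg
    | algebraMap r =>
      intro q hq
      rw [mul_comm, ← Algebra.smul_def]
      exact M.smul_mem r hq
    | add a b _ _ ha hb =>
      intro q hq
      rw [mul_add]
      exact add_mem (ha q hq) (hb q hq)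
    | mul a b _ _ ha hb =>
      intro q hq
      rw [← mul_assoc]
      exact hb _ (ha q hq)
  have one_mem : (1 : TripleRing K d) ∈ M := fun t ht => by
    rw [mul_one]
    exact hV.commMap_mem_of_multilinearFactor ht
  have h := all 1 one_mem 1 .one
  rwa [one_mul, one_mul] at h

end IsConstantSubmodule

section Constants

variable {δ : LieDerivation K (FreeMetabelian K d) (FreeMetabelian K d)}

/-- The subspace of constants in the commutator ideal. -/
def constants (δ : LieDerivation K (FreeMetabelian K d) (FreeMetabelian K d)) :
    Submodule K (FreeMetabelian K d) :=
  (derivedIdeal K d).toSubmodule ⊓ LinearMap.ker (δ : FreeMetabelian K d →ₗ[K] FreeMetabelian K d)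

lemma mem_constants {w : FreeMetabelian K d} :
    w ∈ constants δ ↔ w ∈ derivedIdeal K d ∧ δ w = 0 := Iff.rfl

lemma isConstantSubmodule_constants (hx : ∀ i : Fin d, δ (xL K d i) = 0)
    (hy : ∀ i : Fin d, δ (yL K d i) = xL K d i) : IsConstantSubmodule (constants δ) where
  gset_subset := by
    rintro g (((((⟨i, rfl⟩ | ⟨i, j, -, rfl⟩) | ⟨i, j, -, rfl⟩) | ⟨i, p, q, -, rfl⟩) |
      ⟨i, j, k, -, -, rfl⟩) | ⟨i, j, p, q, -, -, rfl⟩)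
    · refine mem_constants.2 ⟨lie_mem_derived _ _, ?_⟩
      simp [hx, hy]
    · refine mem_constants.2 ⟨lie_mem_derived _ _, ?_⟩
      simp [hx]
    · refine mem_constants.2 ⟨add_mem (lie_mem_derived _ _) (lie_mem_derived _ _), ?_⟩
      simp only [LieDerivation.apply_lie_eq_add, hx, hy, map_add, zero_lie, add_zero]
      rw [← lie_skew, neg_add_cancel]
    · refine mem_constants.2 ⟨sub_mem (lie_mem_derived _ _) (lie_mem_derived _ _), ?_⟩
      simp only [LieDerivation.apply_lie_eq_add, hx, hy, map_sub, zero_lie, add_zero, lie_zero,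
        zero_add, sub_self]
    · refine mem_constants.2 ⟨add_mem (sub_mem (lie_mem_derived _ _) (lie_mem_derived _ _))
        (lie_mem_derived _ _), ?_⟩
      simp only [LieDerivation.apply_lie_eq_add, hx, hy, map_add, map_sub, zero_lie, add_zero,
        lie_zero]
      rw [lie_lie_sub, neg_add_cancel]
    · refine mem_constants.2 ⟨sub_mem (sub_mem (add_mem (lie_mem_derived _ _)
        (lie_mem_derived _ _)) (lie_mem_derived _ _)) (lie_mem_derived _ _), ?_⟩
      simp only [LieDerivation.apply_lie_eq_add, hx, hy, map_add, map_sub, zero_lie, add_zero,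
        lie_zero, zero_add, add_lie]
      abel
  lie_x_mem w hw i := by
    rw [mem_constants] at hw ⊢
    exact ⟨lie_mem_derived _ _, by simp [hx, hw.2]⟩
  lie_minor_mem w hw p q _ := by
    rw [mem_constants] at hw ⊢
    refine ⟨sub_mem (lie_mem_derived _ _) (lie_mem_derived _ _), ?_⟩
    simp only [LieDerivation.apply_lie_eq_add, hx, hy, hw.2, map_sub, zero_lie, add_zero, lie_zero]
    rw [lie_lie_comm hw.1, sub_self]

lemma constants_le [CharZero K] (hx : ∀ i : Fin d, δ (xL K d i) = 0)
    (hy : ∀ i : Fin d, δ (yL K d i) = xL K d i) {V : Submodule K (FreeMetabelian K d)}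
    (hV : IsConstantSubmodule V) : constants δ ≤ V := by
  have adjoin_mem {m : FreeMetabelian K d} (hm : m ∈ constants δ) :
      polarize K d (magnusCoord K d m) ∈
        Algebra.adjoin K (nowickiGenerators K (Fin 3 × Fin d)) := by
    refine mem_adjoin_of_shiftDer_eq_zero ?_
    rw [shiftDer_polarize, ← magnusCoord_derivation hx hy, (mem_constants.1 hm).2, map_zero,
      map_zero]
  have degreeOp_mem {W : Submodule K (FreeMetabelian K d)} (hW : IsConstantSubmodule W)
      {m : FreeMetabelian K d} (hm : m ∈ constants δ) : degreeOp K d m ∈ W := by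
    rw [degreeOp_apply]
    exact neg_mem (hW.commMap_mem (adjoin_mem hm))
  refine Submodule.le_of_inf_eigenspace_le (f := degreeOp K d)
    (fun m hm => degreeOp_mem (isConstantSubmodule_constants hx hy) hm) (fun m hm => ?_)
    fun c m hmc => ?_
  · exact (iSup_le fun k => le_iSup (degreeOp K d).eigenspace _ :
      (⨆ k : ℕ, (degreeOp K d).eigenspace ((k : K) + 2)) ≤ _)
      (derivedIdeal_le_iSup (mem_constants.1 hm).1)
  · obtain ⟨hm, hc⟩ := Submodule.mem_inf.1 hmc
    rw [Module.End.mem_eigenspace_iff] at hc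
    have h := degreeOp_mem hV hm
    rw [hc] at h
    rcases eq_or_ne c 0 with rfl | hc0
    · rw [zero_smul] at hc
      rw [eq_zero_of_degreeOp_eq_zero (mem_constants.1 hm).1 hc]
      exact zero_mem V
    · exact (V.smul_mem_iff hc0).1 h

end Constants

end FreeMetabelian

/-- The set of constants of `δ` in the commutator ideal `F_{2d}'` is the smallest
`K`-linear subspace of `F_{2d}` containing `G` and closed under the operators
`w ↦ [w, xᵢ]` and `w ↦ [[w, x_p], y_q] - [[w, x_q], y_p]` (`p < q`), i.e. `G` generates
`(F_{2d}')^δ` as a `K[X_d,Y_d]^δ`-module. -/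
theorem constants_smallest_subspace (K : Type*) [Field K] [CharZero K] (d : ℕ) (hd : 2 ≤ d)
    (δ : LieDerivation K (FreeMetabelian K d) (FreeMetabelian K d))
    (hx : ∀ i : Fin d, δ (xL K d i) = 0)
    (hy : ∀ i : Fin d, δ (yL K d i) = xL K d i) :
    {w : FreeMetabelian K d |
        w ∈ LieAlgebra.derivedSeries K (FreeMetabelian K d) 1 ∧ δ w = 0} =
      ⋂ V ∈ {V : Submodule K (FreeMetabelian K d) |
          Gset K d ⊆ (V : Set (FreeMetabelian K d)) ∧
          (∀ w ∈ V, ∀ i : Fin d, ⁅w, xL K d i⁆ ∈ V) ∧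
          (∀ w ∈ V, ∀ p q : Fin d, p < q →
            ⁅⁅w, xL K d p⁆, yL K d q⁆ - ⁅⁅w, xL K d q⁆, yL K d p⁆ ∈ V)},
        (V : Set (FreeMetabelian K d)) := by
  refine Set.Subset.antisymm (fun w hw => Set.mem_iInter₂.2 fun V hV => ?_) fun w hw => ?_
  · exact constants_le hx hy ⟨hV.1, hV.2.1, hV.2.2⟩ (mem_constants.2 hw)
  · have h := isConstantSubmodule_constants hx hy
    exact mem_constants.1 (Set.mem_iInter₂.1 hw (constants δ)
      ⟨h.gset_subset, h.lie_x_mem, h.lie_minor_mem⟩)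

end
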